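/- An operator A ∈ B(F²(Hₙ)) is multi-Toeplitz (i.e., Rᵢ* A Rⱼ = δᵢⱼ A for all i, j ∈ {1,…,n}) if and only if A belongs to the closure, in the weak operator topology on B(F²(Hₙ)), of the linear span of {S_α : α ∈ 𝔽ₙ⁺} ∪ {S_α* : α ∈ 𝔽ₙ⁺}. Moreover, this weak-operator-topology closure coincides with the closure of the same linear span in the strong operator topology (the topology of pointwise norm convergence on F²(Hₙ)). -/

import Mathlib

open scoped ENNReal ComplexOrder
open Filter ContinuousLinearMap

noncomputable section

abbrev Word (n : ℕ) := FreeMonoid (Fin n)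

/-- The word determined by a tuple of letters. -/
def word {n k : ℕ} (f : Fin k → Fin n) : Word n :=
  FreeMonoid.ofList (List.ofFn f)

/-- The length of a word. -/
def wordLen {n : ℕ} (α : Word n) : ℕ := (FreeMonoid.toList α).length

/-- The product `X_α = X_{i₁} ⋯ X_{i_k}` for `α = g_{i₁} ⋯ g_{i_k}`. -/
def wordProd {n : ℕ} {K : Type} [NormedAddCommGroup K] [InnerProductSpace ℂ K]
    (X : Fin n → K →L[ℂ] K) (α : Word n) : K →L[ℂ] K :=
  ((FreeMonoid.toList α).map X).prod

/-- `Σ_{|α| = k} a_α X_α`. -/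
def truncSum {n : ℕ} {K : Type} [NormedAddCommGroup K] [InnerProductSpace ℂ K]
    (a : Word n → ℂ) (X : Fin n → K →L[ℂ] K) (k : ℕ) : K →L[ℂ] K :=
  ∑ f : Fin k → Fin n, a (word f) • wordProd X (word f)

/-- `Σ_{|α| = k} b_α X_α*`. -/
def truncSumAdj {n : ℕ} {K : Type} [NormedAddCommGroup K] [InnerProductSpace ℂ K]
    [CompleteSpace K] (b : Word n → ℂ) (X : Fin n → K →L[ℂ] K) (k : ℕ) : K →L[ℂ] K :=
  ∑ f : Fin k → Fin n, b (word f) • adjoint (wordProd X (word f))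

/-- The free holomorphic function `f(X) = Σ_k Σ_{|α| = k} a_α X_α`. -/
def holOp {n : ℕ} {K : Type} [NormedAddCommGroup K] [InnerProductSpace ℂ K]
    (a : Word n → ℂ) (X : Fin n → K →L[ℂ] K) : K →L[ℂ] K :=
  ∑' k : ℕ, truncSum a X k

/-- The free pluriharmonic function
`u(X) = Σ_{k ≥ 1} Σ_{|α| = k} b_α X_α* + a_{g₀} I + Σ_{k ≥ 1} Σ_{|α| = k} a_α X_α`. -/
def phOp {n : ℕ} {K : Type} [NormedAddCommGroup K] [InnerProductSpace ℂ K]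
    [CompleteSpace K] (a b : Word n → ℂ) (X : Fin n → K →L[ℂ] K) : K →L[ℂ] K :=
  (∑' k : ℕ, truncSumAdj b X (k + 1)) + a 1 • (1 : K →L[ℂ] K)
    + ∑' k : ℕ, truncSum a X (k + 1)

/-- Membership in the open noncommutative ball of radius `γ`. -/
def inBall {n : ℕ} {K : Type} [NormedAddCommGroup K] [InnerProductSpace ℂ K]
    [CompleteSpace K] (γ : ℝ) (X : Fin n → K →L[ℂ] K) : Prop :=
  ‖∑ i, X i * adjoint (X i)‖ < γ ^ 2

/-- Membership in the closed noncommutative ball of radius `γ`. -/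
def inClosedBall {n : ℕ} {K : Type} [NormedAddCommGroup K] [InnerProductSpace ℂ K]
    [CompleteSpace K] (γ : ℝ) (X : Fin n → K →L[ℂ] K) : Prop :=
  ‖∑ i, X i * adjoint (X i)‖ ≤ γ ^ 2

/-- The radius-`γ` condition `limsup_k (Σ_{|α|=k} |a_α|²)^{1/(2k)} ≤ 1/γ`. -/
def radCond {n : ℕ} (γ : ℝ) (a : Word n → ℂ) : Prop :=
  Filter.limsup
    (fun k : ℕ =>
      (∑ f : Fin k → Fin n, (‖a (word f)‖₊ : ℝ≥0∞) ^ 2) ^ ((1 : ℝ) / (2 * (k : ℝ))))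
    Filter.atTop ≤ ENNReal.ofReal (1 / γ)

/-- The coefficients of the radial function: `α ↦ r^{|α|} a_α`. -/
def scaleCoef {n : ℕ} (r : ℝ) (a : Word n → ℂ) : Word n → ℂ :=
  fun α => ((r : ℂ) ^ wordLen α) * a α

/-- Positivity of the free pluriharmonic function with coefficients `(a, b)` on the
noncommutative ball of radius `γ` of every complex Hilbert space. -/
def posPH {n : ℕ} (γ : ℝ) (a b : Word n → ℂ) : Prop :=
  ∀ (K : Type) [NormedAddCommGroup K] [InnerProductSpace ℂ K] [CompleteSpace K],
    ∀ X : Fin n → K →L[ℂ] K, inBall γ X → (phOp a b X).IsPositive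


/-- The linear span of `{S_α} ∪ {S_α*}`. -/
def saSpan {n : ℕ} {F : Type} [NormedAddCommGroup F] [InnerProductSpace ℂ F]
    [CompleteSpace F] (S : Fin n → F →L[ℂ] F) : Submodule ℂ (F →L[ℂ] F) :=
  Submodule.span ℂ
    ((Set.range fun α : Word n => wordProd S α) ∪
      (Set.range fun α : Word n => adjoint (wordProd S α)))

/-- The multi-Toeplitz condition for an infinite matrix indexed by words. -/
def IsMultiToeplitzMatrix {n : ℕ} (f : Word n → Word n → ℂ) : Prop :=
  ∀ (i j : Fin n) (α β : Word n),
    f (α * FreeMonoid.of i) (β * FreeMonoid.of j) = if i = j then f α β else 0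

instance {n : ℕ} : DecidableEq (Word n) :=
  inferInstanceAs (DecidableEq (List (Fin n)))

theorem wordLen_mul {n : ℕ} (α β : Word n) : wordLen (α * β) = wordLen α + wordLen β := by
  simp [wordLen]

@[simp]
theorem wordLen_of {n : ℕ} (i : Fin n) : wordLen (FreeMonoid.of i) = 1 := by
  simp [wordLen]

@[simp]
theorem wordLen_one {n : ℕ} : wordLen (1 : Word n) = 0 := by
  simp [wordLen]

theorem mul_of_inj {n : ℕ} {α β : Word n} {i j : Fin n} :
    α * FreeMonoid.of i = β * FreeMonoid.of j ↔ α = β ∧ i = j := by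
  constructor
  · intro h
    have h' : FreeMonoid.toList α ++ [i] = FreeMonoid.toList β ++ [j] :=
      congrArg FreeMonoid.toList h
    obtain ⟨h₁, h₂⟩ := List.append_inj' h' rfl
    exact ⟨FreeMonoid.toList.injective h₁, by simpa using h₂⟩
  · rintro ⟨rfl, rfl⟩
    rfl

theorem word_right_induction {n : ℕ} {P : Word n → Prop} (one : P 1)
    (mul_of : ∀ α i, P α → P (α * FreeMonoid.of i)) (α : Word n) : P α :=
  List.reverseRecOn (motive := fun l => P (FreeMonoid.ofList l)) (FreeMonoid.toList α) one
    fun l i h => mul_of (FreeMonoid.ofList l) i h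

/-- A multi-Toeplitz matrix is determined by its first row and its first column. -/
theorem IsMultiToeplitzMatrix.ext {n : ℕ} {f g : Word n → Word n → ℂ}
    (hf : IsMultiToeplitzMatrix f) (hg : IsMultiToeplitzMatrix g)
    (hcol : ∀ α, f α 1 = g α 1) (hrow : ∀ β, f 1 β = g 1 β) (α β : Word n) :
    f α β = g α β := by
  induction α using word_right_induction generalizing β with
  | one => exact hrow β
  | mul_of α i ih =>
    induction β using word_right_induction with
    | one => exact hcol _
    | mul_of β j _ => rw [hf, hg, ih]

/-- The finite set of words of length less than `N`. -/
def wordsLT (n N : ℕ) : Finset (Word n) :=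
  (List.finite_length_lt (Fin n) N).toFinset

theorem mem_wordsLT {n N : ℕ} {α : Word n} : α ∈ wordsLT n N ↔ wordLen α < N :=
  Set.Finite.mem_toFinset _

/-- The Fejér weight `max (1 - |k - l| / N) 0`. -/
def fejerWeight (N k l : ℕ) : ℝ :=
  ((min k l + N - max k l : ℕ) : ℝ) / N

theorem fejerWeight_succ_succ (N k l : ℕ) :
    fejerWeight N (k + 1) (l + 1) = fejerWeight N k l := by
  unfold fejerWeight
  congr 2
  omega

theorem fejerWeight_nonneg (N k l : ℕ) : 0 ≤ fejerWeight N k l := by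
  unfold fejerWeight
  positivity

theorem fejerWeight_le_one (N k l : ℕ) : fejerWeight N k l ≤ 1 := by
  unfold fejerWeight
  refine div_le_one_of_le₀ ?_ (Nat.cast_nonneg _)
  exact_mod_cast (by omega)

theorem fejerWeight_eq_zero {N k l : ℕ} (h : min k l + N ≤ max k l) :
    fejerWeight N k l = 0 := by
  simp [fejerWeight, Nat.sub_eq_zero_of_le h]

theorem tendsto_fejerWeight (k l : ℕ) :
    Tendsto (fun N => fejerWeight N k l) atTop (nhds 1) := by
  have h : Tendsto (fun N : ℕ => 1 - ((max k l - min k l : ℕ) : ℝ) / N) atTop (nhds (1 - 0)) :=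
    tendsto_const_nhds.sub (tendsto_const_div_atTop_nhds_zero_nat _)
  rw [sub_zero] at h
  refine h.congr' ?_
  filter_upwards [eventually_gt_atTop (max k l)] with N hN
  have hN0 : (N : ℝ) ≠ 0 := by
    have : 0 < N := by omega
    positivity
  have hsplit : ((min k l + N - max k l : ℕ) : ℝ) = N - ((max k l - min k l : ℕ) : ℝ) := by
    rw [eq_sub_iff_add_eq]
    exact_mod_cast (by omega)
  rw [fejerWeight, hsplit, sub_div, div_self hN0]

/-- The Fejér weight is an average of products of window indicators. -/
theorem sum_window_mul_window {N k l M : ℕ} (hk : k + N ≤ M) (hl : l + N ≤ M) :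
    (∑ j ∈ Finset.range M, (if k ≤ j ∧ j < k + N then (1 : ℝ) else 0) *
      (if l ≤ j ∧ j < l + N then 1 else 0)) = N * fejerWeight N k l := by
  rcases Nat.eq_zero_or_pos N with rfl | hN
  · have h : ∀ j : ℕ, ¬ (k ≤ j ∧ j < k + 0) := by omega
    simp only [h, if_false, zero_mul, Finset.sum_const_zero, Nat.cast_zero]
  have hN0 : (N : ℝ) ≠ 0 := by positivity
  have hset : (Finset.range M).filter
      (fun j => (k ≤ j ∧ j < k + N) ∧ (l ≤ j ∧ j < l + N)) =
      Finset.Ico (max k l) (min k l + N) := by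
    ext j
    simp only [Finset.mem_filter, Finset.mem_range, Finset.mem_Ico]
    omega
  simp_rw [ite_zero_mul_ite_zero, mul_one]
  rw [Finset.sum_boole, hset, Nat.card_Ico, fejerWeight, mul_div_cancel₀ _ hN0]

section Operators

variable {n : ℕ} {F : Type} [NormedAddCommGroup F] [InnerProductSpace ℂ F]

theorem ext_matrix (e : HilbertBasis (Word n) ℂ F) {A B : F →L[ℂ] F}
    (h : ∀ α β, inner ℂ (e α) (A (e β)) = inner ℂ (e α) (B (e β))) : A = B := by
  have hd : Dense (Submodule.span ℂ (Set.range e) : Set F) :=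
    Submodule.dense_iff_topologicalClosure_eq_top.2 e.dense_span
  refine ContinuousLinearMap.ext_on hd ?_
  rintro _ ⟨β, rfl⟩
  refine e.repr.injective (lp.ext (funext fun α => ?_))
  simpa only [e.repr_apply_apply] using h α β

theorem inner_basis (e : HilbertBasis (Word n) ℂ F) (α β : Word n) :
    inner ℂ (e α) (e β) = if α = β then (1 : ℂ) else 0 :=
  orthonormal_iff_ite.1 e.orthonormal α β

theorem wordProd_apply_basis (e : HilbertBasis (Word n) ℂ F) {S : Fin n → F →L[ℂ] F}
    (hS : ∀ (i : Fin n) (α : Word n), S i (e α) = e (FreeMonoid.of i * α)) (γ β : Word n) :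
    wordProd S γ (e β) = e (γ * β) := by
  induction γ using FreeMonoid.inductionOn' with
  | one => simp [wordProd]
  | of_mul i γ ih =>
    have : wordProd S (FreeMonoid.of i * γ) = S i * wordProd S γ := by simp [wordProd]
    rw [this, mul_apply_eq_comp, ih, hS, mul_assoc]

theorem inner_wordProd (e : HilbertBasis (Word n) ℂ F) {S : Fin n → F →L[ℂ] F}
    (hS : ∀ (i : Fin n) (α : Word n), S i (e α) = e (FreeMonoid.of i * α)) (γ α β : Word n) :
    inner ℂ (e α) (wordProd S γ (e β)) = if α = γ * β then (1 : ℂ) else 0 := by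
  rw [wordProd_apply_basis e hS, inner_basis]

theorem norm_sq_sum_basis (e : HilbertBasis (Word n) ℂ F) (s : Finset (Word n))
    (c : Word n → ℂ) : ‖∑ α ∈ s, c α • e α‖ ^ 2 = ∑ α ∈ s, ‖c α‖ ^ 2 := by
  have h := e.orthonormal.inner_sum c c s
  rw [inner_self_eq_norm_sq_to_K] at h
  simp only [RCLike.conj_mul] at h
  exact_mod_cast h

theorem inner_sum_basis (e : HilbertBasis (Word n) ℂ F) (T : F →L[ℂ] F) (s : Finset (Word n))
    (c d : Word n → ℂ) :
    inner ℂ (∑ α ∈ s, d α • e α) (T (∑ β ∈ s, c β • e β)) =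
      ∑ α ∈ s, ∑ β ∈ s, star (d α) * c β * inner ℂ (e α) (T (e β)) := by
  rw [sum_inner]
  refine Finset.sum_congr rfl fun α _ => ?_
  rw [map_sum, inner_sum]
  refine Finset.sum_congr rfl fun β _ => ?_
  rw [map_smul, inner_smul_left, inner_smul_right, starRingEnd_apply, mul_assoc]

/-- A Fejér-weighted Schur multiple of `A` satisfies the norm bound of `A` on finite sums. -/
theorem norm_inner_sum_basis_le (e : HilbertBasis (Word n) ℂ F) {A T : F →L[ℂ] F} {N : ℕ}
    (hN : 0 < N)
    (hT : ∀ α β, inner ℂ (e α) (T (e β)) =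
      (fejerWeight N (wordLen α) (wordLen β) : ℂ) * inner ℂ (e α) (A (e β)))
    (s : Finset (Word n)) (c d : Word n → ℂ) :
    ‖inner ℂ (∑ α ∈ s, d α • e α) (T (∑ β ∈ s, c β • e β))‖ ≤
      ‖A‖ * ‖∑ β ∈ s, c β • e β‖ * ‖∑ α ∈ s, d α • e α‖ := by
  set M := s.sup wordLen + N
  have hM : ∀ α ∈ s, wordLen α + N ≤ M := fun α hα =>
    Nat.add_le_add_right (Finset.le_sup (f := wordLen) hα) N
  have hN0 : (0 : ℝ) < N := by exact_mod_cast hN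
  let v : ℕ → Word n → ℝ := fun j α => if wordLen α ≤ j ∧ j < wordLen α + N then 1 else 0
  have hv : ∀ α ∈ s, ∀ β ∈ s, ∑ j ∈ Finset.range M, v j α * v j β =
      N * fejerWeight N (wordLen α) (wordLen β) := fun α hα β hβ =>
    sum_window_mul_window (hM α hα) (hM β hβ)
  let cut : (Word n → ℂ) → ℕ → F := fun c j => ∑ α ∈ s, ((v j α : ℂ) * c α) • e α
  have hcut : ∀ c : Word n → ℂ, ∑ j ∈ Finset.range M, ‖cut c j‖ ^ 2 =
      N * ‖∑ α ∈ s, c α • e α‖ ^ 2 := by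
    intro c
    simp only [cut, norm_sq_sum_basis]
    rw [Finset.sum_comm, Finset.mul_sum]
    refine Finset.sum_congr rfl fun α hα => ?_
    have hw : fejerWeight N (wordLen α) (wordLen α) = 1 := by
      simp [fejerWeight, hN0.ne']
    have h := hv α hα α hα
    rw [hw, mul_one] at h
    rw [← h, Finset.sum_mul]
    refine Finset.sum_congr rfl fun j _ => ?_
    rw [norm_mul, mul_pow, Complex.norm_real, Real.norm_eq_abs, sq_abs, sq (v j α)]
  have hsum : (N : ℂ) * inner ℂ (∑ α ∈ s, d α • e α) (T (∑ β ∈ s, c β • e β)) =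
      ∑ j ∈ Finset.range M, inner ℂ (cut d j) (A (cut c j)) := by
    simp only [cut, inner_sum_basis]
    rw [Finset.sum_comm (s := Finset.range M), Finset.mul_sum]
    refine Finset.sum_congr rfl fun α hα => ?_
    rw [Finset.sum_comm (s := Finset.range M), Finset.mul_sum]
    refine Finset.sum_congr rfl fun β hβ => ?_
    have h : (∑ j ∈ Finset.range M, (v j α : ℂ) * v j β) =
        N * fejerWeight N (wordLen α) (wordLen β) := by
      exact_mod_cast hv α hα β hβ
    rw [hT]
    calc _ = ((N : ℂ) * fejerWeight N (wordLen α) (wordLen β)) *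
          (star (d α) * c β * inner ℂ (e α) (A (e β))) := by ring
      _ = _ := by
        rw [← h, Finset.sum_mul]
        refine Finset.sum_congr rfl fun j _ => ?_
        have : star (v j α : ℂ) = v j α := Complex.conj_ofReal _
        rw [star_mul', this]
        ring
  have hbound : (N : ℝ) * ‖inner ℂ (∑ α ∈ s, d α • e α) (T (∑ β ∈ s, c β • e β))‖ ≤
      N * (‖A‖ * ‖∑ β ∈ s, c β • e β‖ * ‖∑ α ∈ s, d α • e α‖) := by
    calc _ = ‖(N : ℂ) * inner ℂ (∑ α ∈ s, d α • e α) (T (∑ β ∈ s, c β • e β))‖ := by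
          rw [norm_mul, Complex.norm_natCast]
      _ ≤ ∑ j ∈ Finset.range M, ‖inner ℂ (cut d j) (A (cut c j))‖ := by
          rw [hsum]
          exact norm_sum_le _ _
      _ ≤ ∑ j ∈ Finset.range M, ‖A‖ * (‖cut d j‖ * ‖cut c j‖) := by
          refine Finset.sum_le_sum fun j _ => (norm_inner_le_norm _ _).trans ?_
          calc _ ≤ ‖cut d j‖ * (‖A‖ * ‖cut c j‖) := by gcongr; exact A.le_opNorm _
            _ = _ := by ring
      _ ≤ ‖A‖ * (√(∑ j ∈ Finset.range M, ‖cut d j‖ ^ 2) *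
            √(∑ j ∈ Finset.range M, ‖cut c j‖ ^ 2)) := by
          rw [← Finset.mul_sum]
          gcongr
          exact Real.sum_mul_le_sqrt_mul_sqrt _ _ _
      _ = _ := by
          rw [hcut, hcut, Real.sqrt_mul hN0.le, Real.sqrt_mul hN0.le,
            Real.sqrt_sq (norm_nonneg _), Real.sqrt_sq (norm_nonneg _)]
          linear_combination (‖A‖ * ‖∑ β ∈ s, c β • e β‖ * ‖∑ α ∈ s, d α • e α‖) *
            Real.mul_self_sqrt hN0.le
  exact le_of_mul_le_mul_left hbound hN0

theorem denseRange_linearCombination (e : HilbertBasis (Word n) ℂ F) :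
    DenseRange (Finsupp.linearCombination ℂ e) := by
  have hd : Dense (Submodule.span ℂ (Set.range e) : Set F) :=
    Submodule.dense_iff_topologicalClosure_eq_top.2 e.dense_span
  rw [← Finsupp.range_linearCombination] at hd
  exact hd

theorem norm_le_of_fejerWeight (e : HilbertBasis (Word n) ℂ F) {A T : F →L[ℂ] F} {N : ℕ}
    (hN : 0 < N)
    (hT : ∀ α β, inner ℂ (e α) (T (e β)) =
      (fejerWeight N (wordLen α) (wordLen β) : ℂ) * inner ℂ (e α) (A (e β))) :
    ‖T‖ ≤ ‖A‖ := by
  have h : ∀ x y : F, ‖inner ℂ y (T x)‖ ≤ ‖A‖ * ‖x‖ * ‖y‖ := by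
    intro x y
    refine (denseRange_linearCombination e).induction_on₂
      (p := fun x y => ‖inner ℂ y (T x)‖ ≤ ‖A‖ * ‖x‖ * ‖y‖) ?_ ?_ x y
    · exact isClosed_le (by fun_prop) (by fun_prop)
    · intro c d
      have hsum : ∀ (c : Word n →₀ ℂ) {s : Finset (Word n)}, c.support ⊆ s →
          Finsupp.linearCombination ℂ e c = ∑ α ∈ s, c α • e α := fun c s hs => by
        rw [Finsupp.linearCombination_apply, Finsupp.sum_of_support_subset _ hs _ (by simp)]
      rw [hsum c (Finset.subset_union_left (s₂ := d.support)),
        hsum d (Finset.subset_union_right (s₁ := c.support))]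
      exact norm_inner_sum_basis_le e hN hT _ _ _
  refine ContinuousLinearMap.opNorm_le_bound _ (norm_nonneg _) fun x => ?_
  have hx := h x (T x)
  rw [inner_self_eq_norm_sq_to_K] at hx
  rcases (norm_nonneg (T x)).eq_or_lt with h0 | h0
  · rw [← h0]
    positivity
  · refine le_of_mul_le_mul_right ?_ h0
    simpa [sq] using hx

theorem tendsto_fejerWeight_basis (e : HilbertBasis (Word n) ℂ F) {A : F →L[ℂ] F}
    {T : ℕ → F →L[ℂ] F}
    (hT : ∀ N α β, inner ℂ (e α) (T N (e β)) =
      (fejerWeight N (wordLen α) (wordLen β) : ℂ) * inner ℂ (e α) (A (e β))) (β : Word n) :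
    Tendsto (fun N => T N (e β)) atTop (nhds (A (e β))) := by
  have hparseval : ∀ x : F, ∑' α, ‖inner ℂ (e α) x‖ ^ 2 = ‖x‖ ^ 2 := by
    intro x
    have h := e.tsum_inner_mul_inner x x
    rw [inner_self_eq_norm_sq_to_K] at h
    simp_rw [← inner_conj_symm x (e _), RCLike.conj_mul] at h
    exact_mod_cast h
  have hdiff : ∀ N α, ‖inner ℂ (e α) (T N (e β) - A (e β))‖ =
      |fejerWeight N (wordLen α) (wordLen β) - 1| * ‖inner ℂ (e α) (A (e β))‖ := by
    intro N α
    rw [inner_sub_right, hT, ← sub_one_mul, norm_mul, ← Real.norm_eq_abs, ← Complex.norm_real]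
    push_cast
    rfl
  have hlim : Tendsto (fun N => ∑' α, ‖inner ℂ (e α) (T N (e β) - A (e β))‖ ^ 2) atTop
      (nhds (∑' _ : Word n, (0 : ℝ))) := by
    refine tendsto_tsum_of_dominated_convergence
      (bound := fun α => ‖inner ℂ (e α) (A (e β))‖ ^ 2)
      (e.orthonormal.inner_products_summable (A (e β))) (fun α => ?_)
      (Eventually.of_forall fun N α => ?_)
    · simp only [hdiff]
      have h := ((((tendsto_fejerWeight (wordLen α) (wordLen β)).sub_const 1).abs.mul_const
        ‖inner ℂ (e α) (A (e β))‖).pow 2)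
      simpa using h
    · rw [hdiff, mul_pow, Real.norm_eq_abs, abs_of_nonneg (by positivity)]
      refine mul_le_of_le_one_left (by positivity) (pow_le_one₀ (abs_nonneg _) ?_)
      rw [abs_le]
      constructor <;>
        linarith [fejerWeight_nonneg N (wordLen α) (wordLen β),
          fejerWeight_le_one N (wordLen α) (wordLen β)]
  simp only [hparseval, tsum_zero] at hlim
  rw [tendsto_iff_norm_sub_tendsto_zero]
  simpa using hlim.sqrt

theorem wot_approx_of_sot_approx {V : Submodule ℂ (F →L[ℂ] F)} {A : F →L[ℂ] F}
    (h : ∀ ε : ℝ, 0 < ε → ∀ (m : ℕ) (x : Fin m → F),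
      ∃ T ∈ V, ∀ p : Fin m, ‖(A - T) (x p)‖ < ε)
    (ε : ℝ) (hε : 0 < ε) (m : ℕ) (x y : Fin m → F) :
    ∃ T ∈ V, ∀ p : Fin m, ‖(inner ℂ ((A - T) (x p)) (y p) : ℂ)‖ < ε := by
  have hpos : 0 < ∑ p, ‖y p‖ + 1 := by positivity
  obtain ⟨T, hT, hTx⟩ := h (ε / (∑ p, ‖y p‖ + 1)) (by positivity) m x
  refine ⟨T, hT, fun p => ?_⟩
  have hy : ‖y p‖ ≤ ∑ p, ‖y p‖ :=
    Finset.single_le_sum (f := fun p => ‖y p‖) (fun _ _ => norm_nonneg _) (Finset.mem_univ p)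
  calc _ ≤ ‖(A - T) (x p)‖ * ‖y p‖ := norm_inner_le_norm _ _
    _ ≤ ‖(A - T) (x p)‖ * (∑ p, ‖y p‖ + 1) := by gcongr; linarith
    _ < ε / (∑ p, ‖y p‖ + 1) * (∑ p, ‖y p‖ + 1) := by gcongr; exact hTx p
    _ = ε := div_mul_cancel₀ _ hpos.ne'

variable [CompleteSpace F]

theorem isMultiToeplitzMatrix_iff (e : HilbertBasis (Word n) ℂ F) {R : Fin n → F →L[ℂ] F}
    (hR : ∀ (i : Fin n) (α : Word n), R i (e α) = e (α * FreeMonoid.of i)) (A : F →L[ℂ] F) :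
    (∀ i j : Fin n, adjoint (R i) ∘L A ∘L R j = if i = j then A else 0) ↔
      IsMultiToeplitzMatrix fun α β => inner ℂ (e α) (A (e β)) := by
  have key : ∀ i j α β, inner ℂ (e α) ((adjoint (R i) ∘L A ∘L R j) (e β)) =
      inner ℂ (e (α * FreeMonoid.of i)) (A (e (β * FreeMonoid.of j))) := by
    intro i j α β
    simp only [ContinuousLinearMap.comp_apply, adjoint_inner_right, hR]
  constructor
  · intro h i j α β
    simp only [← key, h]
    split_ifs <;> simp
  · intro h i j
    refine ext_matrix e fun α β => ?_
    rw [key]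
    refine (h i j α β).trans ?_
    split_ifs <;> simp

theorem inner_adjoint_wordProd (e : HilbertBasis (Word n) ℂ F) {S : Fin n → F →L[ℂ] F}
    (hS : ∀ (i : Fin n) (α : Word n), S i (e α) = e (FreeMonoid.of i * α)) (γ α β : Word n) :
    inner ℂ (e α) (adjoint (wordProd S γ) (e β)) = if γ * α = β then (1 : ℂ) else 0 := by
  rw [adjoint_inner_right, wordProd_apply_basis e hS, inner_basis]

theorem isMultiToeplitzMatrix_of_mem_saSpan (e : HilbertBasis (Word n) ℂ F)
    {S : Fin n → F →L[ℂ] F}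
    (hS : ∀ (i : Fin n) (α : Word n), S i (e α) = e (FreeMonoid.of i * α))
    {T : F →L[ℂ] F} (hT : T ∈ saSpan S) :
    IsMultiToeplitzMatrix fun α β => inner ℂ (e α) (T (e β)) := by
  induction hT using Submodule.span_induction with
  | mem T hT =>
    rcases hT with ⟨γ, rfl⟩ | ⟨γ, rfl⟩ <;> intro i j α β
    · simp only [inner_wordProd e hS, ← mul_assoc, mul_of_inj]
      split_ifs <;> simp_all
    · simp only [inner_adjoint_wordProd e hS, ← mul_assoc, mul_of_inj]
      split_ifs <;> simp_all
  | zero => intro i j α β; simp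
  | add T U _ _ hT hU =>
    intro i j α β
    have h₁ := hT i j α β
    have h₂ := hU i j α β
    simp only [add_apply, inner_add_right] at *
    rw [h₁, h₂]
    split_ifs <;> simp
  | smul c T _ hT =>
    intro i j α β
    have h := hT i j α β
    simp only [smul_apply, inner_smul_right] at *
    rw [h]
    split_ifs <;> simp

/-- The Fejér mean of order `N` of the operator `A`. -/
def fejerMean (e : HilbertBasis (Word n) ℂ F) (S : Fin n → F →L[ℂ] F) (A : F →L[ℂ] F) (N : ℕ) :
    F →L[ℂ] F :=
  (∑ γ ∈ wordsLT n N,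
      ((fejerWeight N (wordLen γ) 0 : ℂ) * inner ℂ (e γ) (A (e 1))) • wordProd S γ) +
    ∑ γ ∈ (wordsLT n N).erase 1,
      ((fejerWeight N 0 (wordLen γ) : ℂ) * inner ℂ (e 1) (A (e γ))) • adjoint (wordProd S γ)

theorem fejerMean_mem_saSpan (e : HilbertBasis (Word n) ℂ F) (S : Fin n → F →L[ℂ] F)
    (A : F →L[ℂ] F) (N : ℕ) : fejerMean e S A N ∈ saSpan S :=
  add_mem
    (sum_mem fun γ _ => Submodule.smul_mem _ _ (Submodule.subset_span (Or.inl ⟨γ, rfl⟩)))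
    (sum_mem fun γ _ => Submodule.smul_mem _ _ (Submodule.subset_span (Or.inr ⟨γ, rfl⟩)))

theorem inner_fejerMean (e : HilbertBasis (Word n) ℂ F) {S : Fin n → F →L[ℂ] F}
    (hS : ∀ (i : Fin n) (α : Word n), S i (e α) = e (FreeMonoid.of i * α))
    {A : F →L[ℂ] F} (hA : IsMultiToeplitzMatrix fun α β => inner ℂ (e α) (A (e β)))
    (N : ℕ) (α β : Word n) :
    inner ℂ (e α) (fejerMean e S A N (e β)) =
      (fejerWeight N (wordLen α) (wordLen β) : ℂ) * inner ℂ (e α) (A (e β)) := by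
  have hexp : ∀ α β : Word n, inner ℂ (e α) (fejerMean e S A N (e β)) =
      (∑ γ ∈ wordsLT n N, ((fejerWeight N (wordLen γ) 0 : ℂ) * inner ℂ (e γ) (A (e 1))) *
          (if α = γ * β then 1 else 0)) +
        ∑ γ ∈ (wordsLT n N).erase 1, ((fejerWeight N 0 (wordLen γ) : ℂ) *
          inner ℂ (e 1) (A (e γ))) * (if γ * α = β then 1 else 0) := by
    intro α β
    simp only [fejerMean, add_apply, sum_apply,
      smul_apply, inner_add_right, inner_sum, inner_smul_right,
      inner_wordProd e hS, inner_adjoint_wordProd e hS]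
  have hweight : IsMultiToeplitzMatrix fun α β : Word n =>
      (fejerWeight N (wordLen α) (wordLen β) : ℂ) * inner ℂ (e α) (A (e β)) := by
    intro i j α β
    have h := hA i j α β
    simp only [wordLen_mul, wordLen_of, fejerWeight_succ_succ] at h ⊢
    rw [h]
    split_ifs <;> simp
  have hmul : ∀ γ δ : Word n, γ * δ = 1 ↔ γ = 1 ∧ δ = 1 := by
    intro γ δ
    constructor
    · intro h
      have := congrArg FreeMonoid.toList h
      exact List.append_eq_nil_iff.1 this
    · rintro ⟨rfl, rfl⟩
      rfl
  refine (isMultiToeplitzMatrix_of_mem_saSpan e hS (fejerMean_mem_saSpan e S A N)).ext hweight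
    (fun α => ?_) (fun β => ?_) α β
  · simp only [hexp, mul_one, wordLen_one]
    have h₂ : ∑ γ ∈ (wordsLT n N).erase 1, ((fejerWeight N 0 (wordLen γ) : ℂ) *
        inner ℂ (e 1) (A (e γ))) * (if γ * α = 1 then 1 else 0) = 0 := by
      refine Finset.sum_eq_zero fun γ hγ => ?_
      rw [if_neg fun h => (Finset.mem_erase.1 hγ).1 ((hmul _ _).1 h).1, mul_zero]
    rw [h₂, add_zero]
    simp only [mul_ite, mul_one, mul_zero, Finset.sum_ite_eq, mem_wordsLT]
    split_ifs with h
    · rfl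
    · rw [fejerWeight_eq_zero (by omega)]
      simp
  · simp only [hexp, mul_one, wordLen_one, eq_comm (a := (1 : Word n)), hmul]
    by_cases hβ : β = 1
    · subst hβ
      have h₂ : ∑ γ ∈ (wordsLT n N).erase 1, ((fejerWeight N 0 (wordLen γ) : ℂ) *
          inner ℂ (e 1) (A (e γ))) * (if γ = 1 then 1 else 0) = 0 := by
        refine Finset.sum_eq_zero fun γ hγ => ?_
        rw [if_neg (Finset.mem_erase.1 hγ).1, mul_zero]
      rw [h₂, add_zero]
      simp only [and_true, mul_ite, mul_one, mul_zero, Finset.sum_ite_eq', mem_wordsLT,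
        wordLen_one]
      split_ifs with h
      · rfl
      · rw [fejerWeight_eq_zero (by omega)]
        simp
    · simp only [hβ, and_false, if_false, mul_zero, Finset.sum_const_zero, zero_add, mul_ite,
        mul_one, Finset.sum_ite_eq', Finset.mem_erase, mem_wordsLT, ne_eq, not_false_eq_true,
        true_and]
      split_ifs with h
      · rfl
      · rw [fejerWeight_eq_zero (by omega)]
        simp

/-- The Fejér means of a multi-Toeplitz operator converge to it strongly. -/
theorem tendsto_fejerMean (e : HilbertBasis (Word n) ℂ F) {S : Fin n → F →L[ℂ] F}
    (hS : ∀ (i : Fin n) (α : Word n), S i (e α) = e (FreeMonoid.of i * α))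
    {A : F →L[ℂ] F} (hA : IsMultiToeplitzMatrix fun α β => inner ℂ (e α) (A (e β))) (x : F) :
    Tendsto (fun N => fejerMean e S A N x) atTop (nhds (A x)) := by
  have hcoef := inner_fejerMean e hS hA
  have hfin : ∀ c : Word n →₀ ℂ,
      Tendsto (fun N => fejerMean e S A N (Finsupp.linearCombination ℂ e c)) atTop
        (nhds (A (Finsupp.linearCombination ℂ e c))) := by
    intro c
    simp only [Finsupp.linearCombination_apply, Finsupp.sum, map_sum, map_smul]
    exact tendsto_finsetSum _ fun α _ =>
      (tendsto_fejerWeight_basis e hcoef α).const_smul (c α)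
  rw [Metric.tendsto_nhds]
  intro ε hε
  have hδ : 0 < ε / (2 * (‖A‖ + ‖A‖ + 1)) := by positivity
  obtain ⟨c, hc⟩ := (denseRange_linearCombination e).exists_dist_lt x hδ
  set y := Finsupp.linearCombination ℂ e c
  filter_upwards [(Metric.tendsto_nhds.1 (hfin c)) (ε / 2) (half_pos hε),
    eventually_gt_atTop 0] with N hNy hN
  have hT := norm_le_of_fejerWeight e hN (hcoef N)
  have h₁ : dist (fejerMean e S A N x) (fejerMean e S A N y) ≤ ‖A‖ * dist x y := by
    rw [dist_eq_norm, dist_eq_norm, ← map_sub]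
    exact ContinuousLinearMap.le_of_opNorm_le _ hT _
  have h₂ : dist (A y) (A x) ≤ ‖A‖ * dist x y := by
    rw [dist_comm, dist_eq_norm, dist_eq_norm, ← map_sub]
    exact A.le_opNorm _
  have h₃ : (‖A‖ + ‖A‖ + 1) * dist x y < ε / 2 := by
    calc _ < (‖A‖ + ‖A‖ + 1) * (ε / (2 * (‖A‖ + ‖A‖ + 1))) := by gcongr
      _ = ε / 2 := by field_simp
  have h₄ := dist_triangle4 (fejerMean e S A N x) (fejerMean e S A N y) (A y) (A x)
  have h₅ := dist_nonneg (x := x) (y := y)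
  linarith

theorem sot_approx_of_isMultiToeplitzMatrix (e : HilbertBasis (Word n) ℂ F)
    {S : Fin n → F →L[ℂ] F}
    (hS : ∀ (i : Fin n) (α : Word n), S i (e α) = e (FreeMonoid.of i * α))
    {A : F →L[ℂ] F} (hA : IsMultiToeplitzMatrix fun α β => inner ℂ (e α) (A (e β)))
    (ε : ℝ) (hε : 0 < ε) (m : ℕ) (x : Fin m → F) :
    ∃ T ∈ saSpan S, ∀ p : Fin m, ‖(A - T) (x p)‖ < ε := by
  have h : ∀ᶠ N in atTop, ∀ p, dist (fejerMean e S A N (x p)) (A (x p)) < ε :=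
    eventually_all.2 fun p => Metric.tendsto_nhds.1 (tendsto_fejerMean e hS hA (x p)) ε hε
  obtain ⟨N, hN⟩ := h.exists
  refine ⟨fejerMean e S A N, fejerMean_mem_saSpan e S A N, fun p => ?_⟩
  rw [sub_apply, ← dist_eq_norm, dist_comm]
  exact hN p

theorem isMultiToeplitzMatrix_of_wot_approx (e : HilbertBasis (Word n) ℂ F)
    {S : Fin n → F →L[ℂ] F}
    (hS : ∀ (i : Fin n) (α : Word n), S i (e α) = e (FreeMonoid.of i * α)) {A : F →L[ℂ] F}
    (h : ∀ ε : ℝ, 0 < ε → ∀ (m : ℕ) (x y : Fin m → F),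
      ∃ T ∈ saSpan S, ∀ p : Fin m, ‖(inner ℂ ((A - T) (x p)) (y p) : ℂ)‖ < ε) :
    IsMultiToeplitzMatrix fun α β => inner ℂ (e α) (A (e β)) := by
  intro i j α β
  refine eq_of_forall_dist_le fun ε hε => ?_
  obtain ⟨T, hT, hTx⟩ := h (ε / 2) (half_pos hε) 2 ![e (β * FreeMonoid.of j), e β]
    ![e (α * FreeMonoid.of i), e α]
  have h₀ := hTx 0
  have h₁ := hTx 1
  have hTtoep := isMultiToeplitzMatrix_of_mem_saSpan e hS hT i j α β
  rw [norm_inner_symm] at h₀ h₁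
  simp only [Matrix.cons_val_zero, Matrix.cons_val_one, sub_apply, inner_sub_right, ← dist_eq_norm] at h₀ h₁
  simp only at hTtoep ⊢
  rw [hTtoep] at h₀
  split_ifs at h₀ ⊢
  · rw [dist_comm] at h₁
    exact (dist_triangle _ _ _).trans (by linarith)
  · linarith

end Operators

/-- An operator is multi-Toeplitz iff it lies in the WOT closure of the span
of `{S_α} ∪ {S_α*}`; moreover, the WOT closure of that span coincides with its SOT closure
(closure membership expressed via approximation on basic neighbourhoods). -/
theorem stmt_3 (n : ℕ) (hn : 1 ≤ n)
    (F : Type) [NormedAddCommGroup F] [InnerProductSpace ℂ F] [CompleteSpace F]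
    (e : HilbertBasis (Word n) ℂ F)
    (S R : Fin n → F →L[ℂ] F)
    (hS : ∀ (i : Fin n) (α : Word n), S i (e α) = e (FreeMonoid.of i * α))
    (hR : ∀ (i : Fin n) (α : Word n), R i (e α) = e (α * FreeMonoid.of i))
    (A : F →L[ℂ] F) :
    ((∀ i j : Fin n, adjoint (R i) ∘L A ∘L R j = if i = j then A else 0) ↔
      (∀ ε : ℝ, 0 < ε → ∀ (m : ℕ) (x y : Fin m → F),
        ∃ T ∈ saSpan S, ∀ p : Fin m, ‖(inner ℂ ((A - T) (x p)) (y p) : ℂ)‖ < ε)) ∧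
    (∀ B : F →L[ℂ] F,
      (∀ ε : ℝ, 0 < ε → ∀ (m : ℕ) (x y : Fin m → F),
        ∃ T ∈ saSpan S, ∀ p : Fin m, ‖(inner ℂ ((B - T) (x p)) (y p) : ℂ)‖ < ε) ↔
      (∀ ε : ℝ, 0 < ε → ∀ (m : ℕ) (x : Fin m → F),
        ∃ T ∈ saSpan S, ∀ p : Fin m, ‖(B - T) (x p)‖ < ε)) := by
  refine ⟨(isMultiToeplitzMatrix_iff e hR A).trans ⟨fun hA => ?_, fun h => ?_⟩,
    fun B => ⟨fun h => ?_, wot_approx_of_sot_approx⟩⟩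
  · exact wot_approx_of_sot_approx (sot_approx_of_isMultiToeplitzMatrix e hS hA)
  · exact isMultiToeplitzMatrix_of_wot_approx e hS h
  · exact sot_approx_of_isMultiToeplitzMatrix e hS (isMultiToeplitzMatrix_of_wot_approx e hS h)

end
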